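/- For integers i ≥ 2, j, k ≥ 1 define the H(curl) interior shape functions on the tetrahedron v^I_{ijk} = ṽ^I_{ijk} + ṽ^II_{ijk} + ṽ^III_{ijk}, v^II_{ijk} = ṽ^I_{ijk} − ṽ^II_{ijk} + ṽ^III_{ijk}, v^III_{ijk} = ṽ^I_{ijk} + ṽ^II_{ijk} − ṽ^III_{ijk}. For l ≥ 2, m, n ≥ 1 and s ∈ {I, II, III} let c^s_{lmn} = ∫_▲ ṽ^s_{lmn} · b̃^s_{lmn} dx dy dz, and assume c^I_{lmn}, c^II_{lmn}, c^III_{lmn} are all nonzero. Define b^I_{lmn} = ½( (c^II_{lmn})^{−1} b̃^II_{lmn} + (c^III_{lmn})^{−1} b̃^III_{lmn} ), b^II_{lmn} = ½( (c^I_{lmn})^{−1} b̃^I_{lmn} − (c^II_{lmn})^{−1} b̃^II_{lmn} ), b^III_{lmn} = ½( (c^I_{lmn})^{−1} b̃^I_{lmn} − (c^III_{lmn})^{−1} b̃^III_{lmn} ). If moreover ∫_▲ ṽ^{ω₁}_{ijk} · b̃^{ω₂}_{lmn} dx dy dz = 0 whenever (i,j,k,ω₁) ≠ (l,m,n,ω₂),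 then for all integers i, l ≥ 2, j, k, m, n ≥ 1 and types T₁, T₂ ∈ {I, II, III}: ∫_▲ v^{T₁}_{ijk} · b^{T₂}_{lmn} dx dy dz = 1 if (i, j, k, T₁) = (l, m, n, T₂) and = 0 otherwise. -/

import Mathlib

open MeasureTheory

/-- Jacobi polynomial `P_n^{(a,b)}` via the Rodrigues formula (on `(-1,1)`). -/
noncomputable def jacobiP (n a b : ℕ) (x : ℝ) : ℝ :=
  (1 / ((2:ℝ)^n * (Nat.factorial n : ℝ) * (1 - x)^a * (1 + x)^b)) *
    iteratedDeriv n (fun t : ℝ => (1 - t)^a * (1 + t)^b * (t^2 - 1)^n) x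

/-- Legendre polynomial `L_n = P_n^{(0,0)}`. -/
noncomputable def legendreP (n : ℕ) (x : ℝ) : ℝ := jacobiP n 0 0 x

/-- Integrated Jacobi polynomial `P̂_n^a(x) = ∫_{-1}^x P_{n-1}^{(a,0)}(t) dt`. -/
noncomputable def intJacobiP (n a : ℕ) (x : ℝ) : ℝ :=
  ∫ t in (-1:ℝ)..x, jacobiP (n - 1) a 0 t

/-- Integrated Legendre polynomial `L̂_n`. -/
noncomputable def intLegendreP (n : ℕ) (x : ℝ) : ℝ := intJacobiP n 0 x

/-- The open reference tetrahedron with vertices `(-1,-1,-1)`, `(1,-1,-1)`,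
`(0,1,-1)`, `(0,0,1)`. -/
def Tet : Set (ℝ × ℝ × ℝ) :=
  {p | -1 < p.2.2 ∧ p.2.2 < 1 ∧ |p.2.1| < (1 - p.2.2) / 2 ∧
       |p.1| < (1 - 2*p.2.1 - p.2.2) / 4}

/-- Euclidean dot product in `ℝ³`. -/
def dot3 (p q : ℝ × ℝ × ℝ) : ℝ := p.1 * q.1 + p.2.1 * q.2.1 + p.2.2 * q.2.2

/-- The collapsed coordinate `η = 4x/(1-2y-z)`. -/
noncomputable def etaT (p : ℝ × ℝ × ℝ) : ℝ := 4*p.1 / (1 - 2*p.2.1 - p.2.2)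

/-- The collapsed coordinate `χ = 2y/(1-z)`. -/
noncomputable def chiT (p : ℝ × ℝ × ℝ) : ℝ := 2*p.2.1 / (1 - p.2.2)

/-- Auxiliary `H(curl)` interior field `ṽ^I_{ijk} = (∇f_i) g_{ij} h_{ijk}` on the
tetrahedron. -/
noncomputable def vtTetI (i j k : ℕ) (p : ℝ × ℝ × ℝ) : ℝ × ℝ × ℝ :=
  (legendreP (i-1) (etaT p) * (((1 - chiT p)/2)^(i-1) * ((1 - p.2.2)/2)^(i-1) *
      intJacobiP j (2*i) (chiT p) * ((1 - p.2.2)/2)^j * intJacobiP k (2*i+2*j) p.2.2),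
   (1/2) * legendreP (i-2) (etaT p) * (((1 - chiT p)/2)^(i-1) * ((1 - p.2.2)/2)^(i-1) *
      intJacobiP j (2*i) (chiT p) * ((1 - p.2.2)/2)^j * intJacobiP k (2*i+2*j) p.2.2),
   (1/4) * legendreP (i-2) (etaT p) * (((1 - chiT p)/2)^(i-1) * ((1 - p.2.2)/2)^(i-1) *
      intJacobiP j (2*i) (chiT p) * ((1 - p.2.2)/2)^j * intJacobiP k (2*i+2*j) p.2.2))

/-- Auxiliary `H(curl)` interior field `ṽ^II_{ijk} = f_i (∇g_{ij}) h_{ijk}` on the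
tetrahedron. -/
noncomputable def vtTetII (i j k : ℕ) (p : ℝ × ℝ × ℝ) : ℝ × ℝ × ℝ :=
  (0,
   jacobiP (j-1) (2*i) 0 (chiT p) * (((1 - p.2.2)/2)^(j-1) * intLegendreP i (etaT p) *
      ((1 - chiT p)/2)^i * ((1 - p.2.2)/2)^i * intJacobiP k (2*i+2*j) p.2.2),
   ((chiT p/2) * jacobiP (j-1) (2*i) 0 (chiT p) - ((j:ℝ)/2) * intJacobiP j (2*i) (chiT p)) *
     (((1 - p.2.2)/2)^(j-1) * intLegendreP i (etaT p) *
      ((1 - chiT p)/2)^i * ((1 - p.2.2)/2)^i * intJacobiP k (2*i+2*j) p.2.2))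

/-- Auxiliary `H(curl)` interior field `ṽ^III_{ijk} = f_i g_{ij} ∇h_{ijk}` on the
tetrahedron. -/
noncomputable def vtTetIII (i j k : ℕ) (p : ℝ × ℝ × ℝ) : ℝ × ℝ × ℝ :=
  (0, 0,
   jacobiP (k-1) (2*i+2*j) 0 p.2.2 * (intLegendreP i (etaT p) * ((1 - chiT p)/2)^i *
      ((1 - p.2.2)/2)^i * intJacobiP j (2*i) (chiT p) * ((1 - p.2.2)/2)^j))

/-- The auxiliary polynomial `Q^{l,m}_1`. -/
noncomputable def Qtet1 (l m : ℕ) (x : ℝ) : ℝ :=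
  jacobiP (m-1) (2*l-1) 1 x + ((m:ℝ) / (2*(l:ℝ) + (m:ℝ) - 1)) * jacobiP (m-1) (2*l) 0 x

/-- The auxiliary polynomial `Q^{l,m}_2`. -/
noncomputable def Qtet2 (l m : ℕ) (x : ℝ) : ℝ :=
  -(x/2) * jacobiP (m-1) (2*l-1) 1 x +
    ((m:ℝ) / (2*(l:ℝ) + (m:ℝ) - 1)) * ((1 - x)/2) * jacobiP (m-1) (2*l) 0 x

/-- Dual candidate `b̃^I_{lmn}` on the tetrahedron. -/
noncomputable def btTetI (l m n : ℕ) (p : ℝ × ℝ × ℝ) : ℝ × ℝ × ℝ :=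
  (legendreP (l-1) (etaT p) * ((1 - chiT p)/2)^(l-1) * jacobiP (m-1) (2*l-1) 1 (chiT p) *
     (((1 - p.2.2)/2)^(l+m-2) * jacobiP (n-1) (2*l+2*m-1) 1 p.2.2),
   0, 0)

/-- Dual candidate `b̃^II_{lmn}` on the tetrahedron. -/
noncomputable def btTetII (l m n : ℕ) (p : ℝ × ℝ × ℝ) : ℝ × ℝ × ℝ :=
  (((l:ℝ) + 1) * jacobiP (l-1) 1 1 (etaT p) * (((1 - chiT p)/2)^(l-1) *
      jacobiP (m-1) (2*l) 0 (chiT p) * ((1 - p.2.2)/2)^(l+m-2) *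
      jacobiP (n-1) (2*l+2*m-1) 1 p.2.2),
   -2*(l:ℝ) * jacobiP (l-2) 1 1 (etaT p) * (((1 - chiT p)/2)^(l-1) *
      jacobiP (m-1) (2*l) 0 (chiT p) * ((1 - p.2.2)/2)^(l+m-2) *
      jacobiP (n-1) (2*l+2*m-1) 1 p.2.2),
   0)

/-- Dual candidate `b̃^III_{lmn}` on the tetrahedron. -/
noncomputable def btTetIII (l m n : ℕ) (p : ℝ × ℝ × ℝ) : ℝ × ℝ × ℝ :=
  (-(((l:ℝ) + 1) / (2*(l:ℝ))) * jacobiP (l-1) 1 1 (etaT p) * ((1 - chiT p)/2)^(l-1) *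
     Qtet1 l m (chiT p) * (((1 - p.2.2)/2)^(l+m-2) * jacobiP (n-1) (2*l+2*m) 0 p.2.2),
   jacobiP (l-2) 1 1 (etaT p) * ((1 - chiT p)/2)^(l-2) * Qtet2 l m (chiT p) *
     (((1 - p.2.2)/2)^(l+m-2) * jacobiP (n-1) (2*l+2*m) 0 p.2.2),
   jacobiP (l-2) 1 1 (etaT p) * ((1 - chiT p)/2)^(l-2) * jacobiP (m-1) (2*l-1) 1 (chiT p) *
     (((1 - p.2.2)/2)^(l+m-2) * jacobiP (n-1) (2*l+2*m) 0 p.2.2))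

/-- The three types of auxiliary `H(curl)` fields / dual candidates. -/
inductive TetType | I | II | III
deriving DecidableEq

/-- The auxiliary `H(curl)` interior fields on the tetrahedron, by type. -/
noncomputable def vtTet : TetType → ℕ → ℕ → ℕ → (ℝ × ℝ × ℝ) → ℝ × ℝ × ℝ
  | .I => vtTetI
  | .II => vtTetII
  | .III => vtTetIII

/-- The dual candidates on the tetrahedron, by type. -/
noncomputable def btTet : TetType → ℕ → ℕ → ℕ → (ℝ × ℝ × ℝ) → ℝ × ℝ × ℝ
  | .I => btTetI
  | .II => btTetII
  | .III => btTetIII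

/-- The `H(curl)` interior shape functions on the tetrahedron, by type. -/
noncomputable def vTet : TetType → ℕ → ℕ → ℕ → (ℝ × ℝ × ℝ) → ℝ × ℝ × ℝ
  | .I => fun i j k p => vtTetI i j k p + vtTetII i j k p + vtTetIII i j k p
  | .II => fun i j k p => vtTetI i j k p - vtTetII i j k p + vtTetIII i j k p
  | .III => fun i j k p => vtTetI i j k p + vtTetII i j k p - vtTetIII i j k p

/-- The diagonal pairing values `c^s_{lmn}`. -/
noncomputable def cTet (s : TetType) (l m n : ℕ) : ℝ :=
  ∫ p in Tet, dot3 (vtTet s l m n p) (btTet s l m n p)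

/-- The dual functions on the tetrahedron, by type. -/
noncomputable def bTet : TetType → ℕ → ℕ → ℕ → (ℝ × ℝ × ℝ) → ℝ × ℝ × ℝ
  | .I => fun l m n p => ((1/2) : ℝ) •
      ((cTet .II l m n)⁻¹ • btTetII l m n p + (cTet .III l m n)⁻¹ • btTetIII l m n p)
  | .II => fun l m n p => ((1/2) : ℝ) •
      ((cTet .I l m n)⁻¹ • btTetI l m n p - (cTet .II l m n)⁻¹ • btTetII l m n p)
  | .III => fun l m n p => ((1/2) : ℝ) •
      ((cTet .I l m n)⁻¹ • btTetI l m n p - (cTet .III l m n)⁻¹ • btTetIII l m n p)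

def Ext1 (f : ℝ → ℝ) : Prop := ∃ g : ℝ → ℝ, Continuous g ∧ ∀ x ∈ Set.Ioo (-1:ℝ) 1, f x = g x

def NiceT (f : ℝ × ℝ × ℝ → ℝ) : Prop := ContinuousOn f Tet ∧ ∃ C, ∀ p ∈ Tet, |f p| ≤ C

lemma NiceT.add {f g : ℝ × ℝ × ℝ → ℝ} (hf : NiceT f) (hg : NiceT g) :
    NiceT (fun p => f p + g p) := by
  obtain ⟨h1, C, hC⟩ := hf
  obtain ⟨h2, D, hD⟩ := hg
  exact ⟨h1.add h2, C + D, fun p hp => (abs_add_le _ _).trans (add_le_add (hC p hp) (hD p hp))⟩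

lemma NiceT.mul {f g : ℝ × ℝ × ℝ → ℝ} (hf : NiceT f) (hg : NiceT g) :
    NiceT (fun p => f p * g p) := by
  obtain ⟨h1, C, hC⟩ := hf
  obtain ⟨h2, D, hD⟩ := hg
  refine ⟨h1.mul h2, C * D, fun p hp => ?_⟩
  rw [abs_mul]
  exact mul_le_mul (hC p hp) (hD p hp) (abs_nonneg _) ((abs_nonneg _).trans (hC p hp))

lemma NiceT.const (c : ℝ) : NiceT (fun _ => c) := ⟨continuousOn_const, |c|, fun _ _ => le_rfl⟩

lemma NiceT.neg {f : ℝ × ℝ × ℝ → ℝ} (hf : NiceT f) : NiceT (fun p => - f p) := by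
  simpa using (NiceT.const (-1)).mul hf

lemma NiceT.sub {f g : ℝ × ℝ × ℝ → ℝ} (hf : NiceT f) (hg : NiceT g) :
    NiceT (fun p => f p - g p) := by
  simpa [sub_eq_add_neg] using hf.add hg.neg

lemma NiceT.divc {f : ℝ × ℝ × ℝ → ℝ} (hf : NiceT f) (c : ℝ) :
    NiceT (fun p => f p / c) := by
  simpa [div_eq_mul_inv] using hf.mul (NiceT.const c⁻¹)

lemma NiceT.pow {f : ℝ × ℝ × ℝ → ℝ} (hf : NiceT f) (n : ℕ) : NiceT (fun p => f p ^ n) := by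
  induction n with
  | zero => simpa using NiceT.const 1
  | succ n ih => simpa [pow_succ] using ih.mul hf

lemma tet_isOpen : IsOpen Tet := by
  have e : Tet = {p : ℝ × ℝ × ℝ | -1 < p.2.2} ∩ ({p | p.2.2 < 1} ∩
      ({p | |p.2.1| < (1 - p.2.2) / 2} ∩ {p | |p.1| < (1 - 2*p.2.1 - p.2.2) / 4})) := rfl
  rw [e]
  refine IsOpen.inter (isOpen_lt (by fun_prop) (by fun_prop)) (IsOpen.inter
    (isOpen_lt (by fun_prop) (by fun_prop)) (IsOpen.inter
    (isOpen_lt (by fun_prop) (by fun_prop)) (isOpen_lt (by fun_prop) (by fun_prop))))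

lemma tet_fin : volume Tet < ⊤ := by
  have : Tet ⊆ Set.Icc ((-1,-1,-1) : ℝ × ℝ × ℝ) (1,1,1) := by
    rintro ⟨x, y, z⟩ ⟨h1, h2, h3, h4⟩
    simp only [abs_lt] at h1 h2 h3 h4
    simp only [Set.mem_Icc, Prod.mk_le_mk]
    refine ⟨⟨?_, ?_, ?_⟩, ?_, ?_, ?_⟩ <;> linarith
  exact (measure_mono this).trans_lt isCompact_Icc.measure_lt_top

lemma NiceT.integrable {f : ℝ × ℝ × ℝ → ℝ} (hf : NiceT f) : IntegrableOn f Tet := by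
  obtain ⟨h1, C, hC⟩ := hf
  have : IsFiniteMeasure (volume.restrict Tet) := ⟨by simpa using tet_fin⟩
  exact Integrable.of_bound
    (h1.aestronglyMeasurable tet_isOpen.measurableSet)
    C (by filter_upwards [ae_restrict_mem tet_isOpen.measurableSet] with p hp using hC p hp)

lemma Ext1.comp {f : ℝ → ℝ} (hf : Ext1 f) {u : ℝ × ℝ × ℝ → ℝ} (hu : ContinuousOn u Tet)
    (hm : ∀ p ∈ Tet, u p ∈ Set.Ioo (-1:ℝ) 1) : NiceT (fun p => f (u p)) := by
  obtain ⟨g, hg, he⟩ := hf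
  obtain ⟨C, hC⟩ := isCompact_Icc.exists_bound_of_continuousOn (s := Set.Icc (-1:ℝ) 1) hg.continuousOn
  refine ⟨(hg.comp_continuousOn hu).congr fun p hp => he _ (hm p hp), C, fun p hp => ?_⟩
  change |f (u p)| ≤ C
  rw [he _ (hm p hp)]
  exact hC _ (Set.Ioo_subset_Icc_self (hm p hp))

lemma iter_poly (n : ℕ) (q : Polynomial ℝ) :
    iteratedDeriv n (fun t => q.eval t) = fun t => (Polynomial.derivative^[n] q).eval t := by
  induction n with
  | zero => simp
  | succ n ih =>
    rw [iteratedDeriv_succ, ih]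
    funext t
    rw [Polynomial.deriv, Function.iterate_succ_apply']

open Polynomial in
lemma ext_jacobi (n a b : ℕ) : Ext1 (jacobiP n a b) := by
  set q : ℝ[X] := (1 - X)^a * (1 + X)^b * (X^2 - 1)^n with hq
  have hd1 : (1 - X : ℝ[X])^(a+n) ∣ q :=
    ⟨(1+X)^b * (-(1+X))^n, by
      rw [hq, show (X^2 - 1 : ℝ[X]) = (1 - X) * (-(1+X)) by ring, mul_pow]; ring⟩
  have hd2 : (1 + X : ℝ[X])^(b+n) ∣ q :=
    ⟨(1-X)^a * (-(1-X))^n, by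
      rw [hq, show (X^2 - 1 : ℝ[X]) = (1 + X) * (-(1-X)) by ring, mul_pow]; ring⟩
  have e1 := pow_sub_dvd_iterate_derivative_of_pow_dvd n hd1
  have e2 := pow_sub_dvd_iterate_derivative_of_pow_dvd n hd2
  rw [Nat.add_sub_cancel] at e1 e2
  have hc : IsCoprime (1 - X : ℝ[X]) (1 + X) :=
    ⟨C (1/2), C (1/2), by
      rw [← mul_add, show (1 - X + (1 + X) : ℝ[X]) = C 2 by
        rw [show (C 2 : ℝ[X]) = 2 from rfl]; ring, ← C_mul]; norm_num⟩
  obtain ⟨r, hr⟩ := (hc.pow (m := a) (n := b)).mul_dvd e1 e2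
  refine ⟨fun x => (1 / ((2:ℝ)^n * (Nat.factorial n : ℝ))) * r.eval x, by fun_prop, ?_⟩
  intro x hx
  have hf : (fun t : ℝ => (1 - t)^a * (1 + t)^b * (t^2 - 1)^n) = fun t => q.eval t := by
    funext t; simp [hq]
  have hit : iteratedDeriv n (fun t => q.eval t) x = (derivative^[n] q).eval x := by
    rw [iter_poly]
  have h1 : (1 - x) ≠ 0 := by linarith [hx.2]
  have h2 : (1 + x) ≠ 0 := by linarith [hx.1]
  have hn : (Nat.factorial n : ℝ) ≠ 0 := by positivity
  simp only [jacobiP, hf, hit, hr]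
  simp only [eval_mul, eval_pow, eval_sub, eval_add, eval_one, eval_X]
  field_simp

lemma ext_int (n a : ℕ) : Ext1 (intJacobiP n a) := by
  obtain ⟨g, hg, he⟩ := ext_jacobi (n-1) a 0
  refine ⟨fun x => ∫ t in (-1:ℝ)..x, g t, 
    intervalIntegral.continuous_primitive (fun a b => hg.intervalIntegrable a b) _, ?_⟩
  intro x hx
  unfold intJacobiP
  refine intervalIntegral.integral_congr_ae (Filter.Eventually.of_forall fun t ht => ?_)
  rw [Set.uIoc_of_le hx.1.le] at ht
  exact he t ⟨ht.1, ht.2.trans_lt hx.2⟩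

lemma eta_c : ContinuousOn etaT Tet := by
  unfold etaT
  refine ContinuousOn.div (by fun_prop) (by fun_prop) ?_
  rintro ⟨x, y, z⟩ ⟨h1, h2, h3, h4⟩
  have := abs_nonneg x
  simp only at *
  linarith

lemma eta_m : ∀ p ∈ Tet, etaT p ∈ Set.Ioo (-1:ℝ) 1 := by
  rintro ⟨x, y, z⟩ ⟨h1, h2, h3, h4⟩
  have := abs_nonneg x
  simp only at *
  have : 0 < 1 - 2 * y - z := by linarith
  rw [abs_lt] at h4
  simp only [etaT, Set.mem_Ioo]
  rw [lt_div_iff₀ this, div_lt_iff₀ this]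
  constructor <;> linarith

lemma chi_c : ContinuousOn chiT Tet := by
  unfold chiT
  refine ContinuousOn.div (by fun_prop) (by fun_prop) ?_
  rintro ⟨x, y, z⟩ ⟨h1, h2, h3, h4⟩
  simp only at *
  linarith

lemma chi_m : ∀ p ∈ Tet, chiT p ∈ Set.Ioo (-1:ℝ) 1 := by
  rintro ⟨x, y, z⟩ ⟨h1, h2, h3, h4⟩
  simp only at *
  have : 0 < 1 - z := by linarith
  rw [abs_lt] at h3
  simp only [chiT, Set.mem_Ioo]
  rw [lt_div_iff₀ this, div_lt_iff₀ this]
  constructor <;> linarith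

lemma z_c : ContinuousOn (fun p : ℝ × ℝ × ℝ => p.2.2) Tet := by fun_prop

lemma z_m : ∀ p ∈ Tet, p.2.2 ∈ Set.Ioo (-1:ℝ) 1 := fun _ h => ⟨h.1, h.2.1⟩

lemma ext_id : Ext1 (fun x => x) := ⟨_, continuous_id, fun _ _ => rfl⟩

lemma nice_eta : NiceT etaT := ext_id.comp eta_c eta_m
lemma nice_chi : NiceT chiT := ext_id.comp chi_c chi_m
lemma nice_z : NiceT (fun p => p.2.2) := ext_id.comp z_c z_m
lemma nice_jeta (n a b : ℕ) : NiceT (fun p => jacobiP n a b (etaT p)) :=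
  (ext_jacobi n a b).comp eta_c eta_m
lemma nice_jchi (n a b : ℕ) : NiceT (fun p => jacobiP n a b (chiT p)) :=
  (ext_jacobi n a b).comp chi_c chi_m
lemma nice_jz (n a b : ℕ) : NiceT (fun p => jacobiP n a b p.2.2) :=
  (ext_jacobi n a b).comp z_c z_m
lemma nice_ieta (n a : ℕ) : NiceT (fun p => intJacobiP n a (etaT p)) :=
  (ext_int n a).comp eta_c eta_m
lemma nice_ichi (n a : ℕ) : NiceT (fun p => intJacobiP n a (chiT p)) :=
  (ext_int n a).comp chi_c chi_m
lemma nice_iz (n a : ℕ) : NiceT (fun p => intJacobiP n a p.2.2) :=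
  (ext_int n a).comp z_c z_m

def Nice3 (F : ℝ × ℝ × ℝ → ℝ × ℝ × ℝ) : Prop :=
  NiceT (fun p => (F p).1) ∧ NiceT (fun p => (F p).2.1) ∧ NiceT (fun p => (F p).2.2)

lemma nice_vt (s : TetType) (i j k : ℕ) : Nice3 (vtTet s i j k) := by
  cases s <;> refine ⟨?_, ?_, ?_⟩ <;>
  simp only [vtTet, vtTetI, vtTetII, vtTetIII, legendreP, intLegendreP] <;>
  repeat' with_reducible first
    | exact NiceT.const _ | exact nice_chi | exact nice_z | exact nice_jeta _ _ _
    | exact nice_jchi _ _ _ | exact nice_jz _ _ _ | exact nice_ieta _ _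
    | exact nice_ichi _ _ | exact nice_iz _ _
    | apply NiceT.add | apply NiceT.sub | apply NiceT.mul | apply NiceT.neg
    | apply NiceT.divc | apply NiceT.pow

lemma nice_bt (s : TetType) (i j k : ℕ) : Nice3 (btTet s i j k) := by
  cases s <;> refine ⟨?_, ?_, ?_⟩ <;>
  simp only [btTet, btTetI, btTetII, btTetIII, legendreP, Qtet1, Qtet2] <;>
  repeat' with_reducible first
    | exact NiceT.const _ | exact nice_chi | exact nice_z | exact nice_jeta _ _ _
    | exact nice_jchi _ _ _ | exact nice_jz _ _ _ | exact nice_ieta _ _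
    | exact nice_ichi _ _ | exact nice_iz _ _
    | apply NiceT.add | apply NiceT.sub | apply NiceT.mul | apply NiceT.neg
    | apply NiceT.divc | apply NiceT.pow

lemma int_dot (s t : TetType) (i j k l m n : ℕ) :
    Integrable (fun p => dot3 (vtTet s i j k p) (btTet t l m n p)) (volume.restrict Tet) := by
  obtain ⟨a1, a2, a3⟩ := nice_vt s i j k
  obtain ⟨b1, b2, b3⟩ := nice_bt t l m n
  exact (((a1.mul b1).add (a2.mul b2)).add (a3.mul b3)).integrable

/-- Coefficients of `v^T` in the auxiliary fields. -/
def sgV : TetType → TetType → ℝ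
  | .II, .II => -1
  | .III, .III => -1
  | _, _ => 1

noncomputable def cfB (l m n : ℕ) : TetType → TetType → ℝ
  | .I, .I => 0
  | .I, t => 1/2 * (cTet t l m n)⁻¹
  | .II, .I => 1/2 * (cTet .I l m n)⁻¹
  | .II, .II => -(1/2 * (cTet .II l m n)⁻¹)
  | .II, .III => 0
  | .III, .I => 1/2 * (cTet .I l m n)⁻¹
  | .III, .II => 0
  | .III, .III => -(1/2 * (cTet .III l m n)⁻¹)

def typs : Finset TetType := {.I, .II, .III}

lemma dot_expand (T₁ T₂ : TetType) (i j k l m n : ℕ) (p : ℝ × ℝ × ℝ) :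
    dot3 (vTet T₁ i j k p) (bTet T₂ l m n p) =
      ∑ s ∈ typs, ∑ t ∈ typs, (sgV T₁ s * cfB l m n T₂ t) *
        dot3 (vtTet s i j k p) (btTet t l m n p) := by
  cases T₁ <;> cases T₂ <;>
  simp [typs, sgV, cfB, dot3, vTet, bTet, vtTet, btTet] <;> ring

/-- Biorthonormality of the `H(curl)` interior shape functions on the
tetrahedron and the dual functions obtained by linear combination. -/
theorem tetrahedron_Hcurl_biorthonormal
    (hne : ∀ (s : TetType) (l m n : ℕ), 2 ≤ l → 1 ≤ m → 1 ≤ n → cTet s l m n ≠ 0)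
    (hoff : ∀ (ω₁ ω₂ : TetType) (i j k l m n : ℕ), 2 ≤ i → 1 ≤ j → 1 ≤ k →
      2 ≤ l → 1 ≤ m → 1 ≤ n → (i, j, k, ω₁) ≠ (l, m, n, ω₂) →
      ∫ p in Tet, dot3 (vtTet ω₁ i j k p) (btTet ω₂ l m n p) = 0) :
    ∀ (T₁ T₂ : TetType) (i j k l m n : ℕ), 2 ≤ i → 2 ≤ l → 1 ≤ j → 1 ≤ k →
      1 ≤ m → 1 ≤ n →
      ∫ p in Tet, dot3 (vTet T₁ i j k p) (bTet T₂ l m n p) =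
        if (i, j, k, T₁) = (l, m, n, T₂) then 1 else 0 := by
  intro T₁ T₂ i j k l m n hi hl hj hk hm hn
  have hsum : ∫ p in Tet, dot3 (vTet T₁ i j k p) (bTet T₂ l m n p) =
      ∑ s ∈ typs, ∑ t ∈ typs, (sgV T₁ s * cfB l m n T₂ t) *
        ∫ p in Tet, dot3 (vtTet s i j k p) (btTet t l m n p) := by
    simp only [dot_expand]
    rw [integral_finsetSum _ fun s _ => integrable_finsetSum _ fun t _ => (int_dot s t i j k l m n).const_mul _]
    refine Finset.sum_congr rfl fun s _ => ?_
    rw [integral_finsetSum _ fun t _ => (int_dot s t i j k l m n).const_mul _]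
    refine Finset.sum_congr rfl fun t _ => ?_
    rw [integral_const_mul]
  rw [hsum]
  by_cases h : (i, j, k) = (l, m, n)
  · obtain ⟨rfl, rfl, rfl⟩ : i = l ∧ j = m ∧ k = n := by simpa using h
    have hval : ∀ s t, ∫ p in Tet, dot3 (vtTet s i j k p) (btTet t i j k p) =
        if s = t then cTet s i j k else 0 := by
      intro s t
      split_ifs with hst
      · subst hst; rfl
      · exact hoff s t i j k i j k hi hj hk hi hj hk (by simpa using hst)
    simp only [hval]
    have n1 := hne .I i j k hi hj hk
    have n2 := hne .II i j k hi hj hk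
    have n3 := hne .III i j k hi hj hk
    cases T₁ <;> cases T₂ <;> simp [typs, sgV, cfB] <;> field_simp <;> norm_num
  · have hz : ∀ s t, ∫ p in Tet, dot3 (vtTet s i j k p) (btTet t l m n p) = 0 := by
      intro s t
      refine hoff s t i j k l m n hi hj hk hl hm hn fun hh => h ?_
      simp only [Prod.mk.injEq] at hh ⊢
      exact ⟨hh.1, hh.2.1, hh.2.2.1⟩
    rw [if_neg]
    · simp [hz]
    · intro hh
      apply h
      simp only [Prod.mk.injEq] at hh ⊢
      exact ⟨hh.1, hh.2.1, hh.2.2.1⟩
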